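/- arXiv:1909.07854 — 3 statements merged into one kernel-verified Lean document; each statement's English description precedes it below -/
import Mathlib

section
/- Let G be a simple graph on vertex set V with a proper 2-coloring c, and let u, v, a, b be four pairwise distinct vertices such that a and b are isolated in G (incident to no edge of G) and c(u) = c(v). Let G' be the graph obtained from G by adding the three edges {u,a}, {v,b}, and {a,b}. Then G' admits a proper 2-coloring if and only if u and v are NOT connected in G. -/
/-- Two proper 2-colorings agree on whether the endpoints of a path have the same color. -/
theorem SimpleGraph.Reachable.bool_coloring_eq_iff {V : Type*} {G : SimpleGraph V} {c c' : V → Bool}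
    (hc : ∀ x y, G.Adj x y → c x ≠ c y) (hc' : ∀ x y, G.Adj x y → c' x ≠ c' y)
    {u v : V} (h : G.Reachable u v) : c u = c v ↔ c' u = c' v := by
  obtain ⟨p⟩ := h
  induction p with
  | nil => simp
  | cons h _ ih =>
    rw [Bool.eq_not.2 (hc _ _ h), Bool.eq_not.2 (hc' _ _ h), Bool.not_eq_eq_eq_not,
      Bool.not_eq_eq_eq_not, Bool.eq_not, Bool.eq_not, Ne, Ne, ih]


/-- Correctness of Case 1 of the reduction from dynamic connectivity to dynamic
2-coloring: if `u` and `v` have the same color and `a`, `b` are fresh isolated vertices,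
then `G + {u,a} + {v,b} + {a,b}` is 2-colorable iff `u` and `v` are not connected in `G`. -/
theorem case1_reduction {V : Type*} (G : SimpleGraph V) (c : V → Bool)
    (hc : ∀ x y, G.Adj x y → c x ≠ c y)
    (u v a b : V)
    (hdist : u ≠ v ∧ u ≠ a ∧ u ≠ b ∧ v ≠ a ∧ v ≠ b ∧ a ≠ b)
    (ha : ∀ w, ¬ G.Adj a w) (hb : ∀ w, ¬ G.Adj b w)
    (huv : c u = c v) :
    (∃ c' : V → Bool, ∀ x y,
        (G ⊔ SimpleGraph.edge u a ⊔ SimpleGraph.edge v b ⊔ SimpleGraph.edge a b).Adj x y →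
        c' x ≠ c' y) ↔ ¬ G.Reachable u v := by
  obtain ⟨-, hua, hub, hva, hvb, hab⟩ := hdist
  constructor
  · rintro ⟨c', hc'⟩ hr
    have huv' : c' u = c' v :=
      (hr.bool_coloring_eq_iff hc fun x y h ↦ hc' x y (by simp [h])).1 huv
    have h₁ : c' u ≠ c' a := hc' u a (by simp [SimpleGraph.edge_adj, hua])
    have h₂ : c' v ≠ c' b := hc' v b (by simp [SimpleGraph.edge_adj, hvb])
    have h₃ : c' a ≠ c' b := hc' a b (by simp [SimpleGraph.edge_adj, hab])
    exact h₃ ((Bool.eq_not.2 h₁.symm).trans (huv' ▸ (Bool.eq_not.2 h₂.symm).symm))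
  · intro hr
    classical
    refine ⟨fun x ↦ if x = a then c u else if x = b then !c u else
      if G.Reachable u x then !c x else c x, fun x y h ↦ ?_⟩
    have hu : G.Reachable u u := .rfl
    simp only [SimpleGraph.sup_adj, SimpleGraph.edge_adj] at h
    rcases h with ((h | h) | h) | h
    · have hxy : G.Reachable u x ↔ G.Reachable u y :=
        ⟨fun hx ↦ hx.trans h.reachable, fun hy ↦ hy.trans h.symm.reachable⟩
      have hne : c x = !c y := Bool.eq_not.2 (hc x y h)
      have := h.symm
      grind
    all_goals grind
end

section
/- Let G be a simple graph on vertex set V with a proper 2-coloring c, and let u, v, a be three pairwise distinct vertices such that a is isolated in G (incident to no edge of G) and c(u) ≠ c(v). Let G' be the graph obtained from G by adding the two edges {u,a} and {v,a}. Then G' admits a proper 2-coloring if and only if u and v are NOT connected in G. -/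
/-- Two proper 2-colorings either agree at both or differ at both of any two connected vertices. -/
theorem eq_iff_eq_of_reachable {V : Type*} {G : SimpleGraph V} {c d : V → Bool}
    (hc : ∀ x y, G.Adj x y → c x ≠ c y) (hd : ∀ x y, G.Adj x y → d x ≠ d y)
    {u v : V} (h : G.Reachable u v) : c u = d u ↔ c v = d v := by
  obtain ⟨p⟩ := h
  induction p with
  | nil => rfl
  | cons hadj _ ih =>
    have h₁ := hc _ _ hadj
    have h₂ := hd _ _ hadj
    rw [← ih, Bool.eq_not.mpr h₁, Bool.eq_not.mpr h₂, Bool.not_inj_iff]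

/-- Correctness of Case 2 of the reduction from dynamic connectivity to dynamic
2-coloring: if `u` and `v` have different colors and `a` is a fresh isolated vertex,
then `G + {u,a} + {v,a}` is 2-colorable iff `u` and `v` are not connected in `G`. -/
theorem case2_reduction {V : Type*} (G : SimpleGraph V) (c : V → Bool)
    (hc : ∀ x y, G.Adj x y → c x ≠ c y)
    (u v a : V)
    (hdist : u ≠ v ∧ u ≠ a ∧ v ≠ a)
    (ha : ∀ w, ¬ G.Adj a w)
    (huv : c u ≠ c v) :
    (∃ c' : V → Bool, ∀ x y,
        (G ⊔ SimpleGraph.edge u a ⊔ SimpleGraph.edge v a).Adj x y → c' x ≠ c' y) ↔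
      ¬ G.Reachable u v := by
  classical
  obtain ⟨-, hua, hva⟩ := hdist
  constructor
  · rintro ⟨d, hd⟩ hreach
    have hG : ∀ x y, G.Adj x y → d x ≠ d y := fun x y h => hd x y (Or.inl (Or.inl h))
    have h₁ : d u ≠ d a := hd u a (by simp [SimpleGraph.edge_adj, hua])
    have h₂ : d v ≠ d a := hd v a (by simp [SimpleGraph.edge_adj, hva])
    have h := eq_iff_eq_of_reachable hc hG hreach
    have hd' : d u = d v := by rw [Bool.eq_not.mpr h₁, Bool.eq_not.mpr h₂]
    rw [hd'] at h
    revert huv h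
    generalize c u = x, c v = y, d v = z
    revert x y z
    decide
  · intro hreach
    refine ⟨fun x => if x = a then c u else if G.Reachable u x then !c x else c x, ?_⟩
    intro x y hxy
    have hu : G.Reachable u u := .refl u
    simp only [SimpleGraph.sup_adj, SimpleGraph.edge_adj] at hxy
    rcases hxy with (hG | h) | h
    · have hxa : x ≠ a := fun h => ha y (h ▸ hG)
      have hya : y ≠ a := fun h => ha x (h ▸ hG.symm)
      have hiff : G.Reachable u x ↔ G.Reachable u y :=
        ⟨fun h => h.trans hG.reachable, fun h => h.trans hG.symm.reachable⟩
      have hxy := hc x y hG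
      simp only [hxa, hya, if_false, hiff]
      split_ifs
      · simpa using hxy
      · exact hxy
    · grind
    · grind
end

section
/- Let G be a simple graph on a finite vertex set whose edge set can be partitioned into γ sets E₁, …, E_γ such that, for each i, the subgraph of G with edge set Eᵢ is acyclic (a forest). Then there is an orientation of the edges of G in which every vertex has out-degree at most γ. (A graph of arboricity γ admits a γ-orientation.) -/
/-- The edges of a forest can be oriented so that every vertex has at most one out-neighbour:
each edge joins exactly one of its endpoints to the parent of that endpoint. -/
theorem SimpleGraph.IsAcyclic.exists_parent {V : Type*} {F : SimpleGraph V} (hF : F.IsAcyclic) :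
    ∃ f : V → V, ∀ u v, F.Adj u v → (f u = v ↔ f v ≠ u) := by
  have hpath (C : F.ConnectedComponent) (v : V) (hv : F.connectedComponentMk v = C) :
      ∃ p : F.Walk C.out v, p.IsPath :=
    (SimpleGraph.ConnectedComponent.exact
      ((Quot.out_eq C).trans hv.symm)).exists_isPath
  choose p hp using hpath
  refine ⟨fun v ↦ (p _ v rfl).penultimate, fun u v huv ↦ ?_⟩
  have hC : F.connectedComponentMk v = F.connectedComponentMk u :=
    SimpleGraph.ConnectedComponent.sound huv.symm.reachable
  have hpen : (p _ v rfl).penultimate = (p _ v hC).penultimate := by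
    generalize F.connectedComponentMk u = C at hC
    subst hC
    rfl
  have hmem {a x y : V} {q : F.Walk a x} (hq : q.IsPath) (hxy : F.Adj x y) :
      q.penultimate = y ↔ y ∈ q.support :=
    ⟨fun h ↦ h ▸ q.getVert_mem_support _, fun h ↦ (hF.eq_penultimate_of_adj_end hq hxy h).symm⟩
  beta_reduce
  rw [ne_eq, hpen, hmem (hp _ u rfl) huv, hmem (hp _ v hC) huv.symm]
  exact ⟨hF.ne_mem_support_of_support_of_adj_of_isPath (hp _ u rfl) (hp _ v hC) huv,
    hF.mem_support_of_ne_mem_support_of_adj_of_isPath (hp _ u rfl) (hp _ v hC) huv⟩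

/-- A graph whose edge set partitions into `γ` forests admits an orientation with
out-degree at most `γ` at every vertex. -/
theorem arboricity_orientation {V : Type*} [Fintype V]
    (G : SimpleGraph V) (γ : ℕ) (H : Fin γ → SimpleGraph V)
    (hle : ∀ i, H i ≤ G)
    (hacyclic : ∀ i, (H i).IsAcyclic)
    (hcover : G.edgeSet = ⋃ i, (H i).edgeSet)
    (hdisj : ∀ i j, i ≠ j → Disjoint (H i).edgeSet (H j).edgeSet) :
    ∃ r : V → V → Prop,
      (∀ u v, G.Adj u v ↔ (r u v ∨ r v u)) ∧
      (∀ u v, r u v → ¬ r v u) ∧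
      (∀ u, {v | r u v}.ncard ≤ γ) := by
  choose f hf using fun i ↦ (hacyclic i).exists_parent
  refine ⟨fun u v ↦ ∃ i, (H i).Adj u v ∧ f i u = v, fun u v ↦ ⟨fun h ↦ ?_, ?_⟩, ?_, fun u ↦ ?_⟩
  · rw [← SimpleGraph.mem_edgeSet, hcover, Set.mem_iUnion] at h
    obtain ⟨i, hi⟩ := h
    rw [SimpleGraph.mem_edgeSet] at hi
    by_cases hv : f i v = u
    · exact .inr ⟨i, hi.symm, hv⟩
    · exact .inl ⟨i, hi, (hf i u v hi).2 hv⟩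
  · rintro (⟨i, hi, -⟩ | ⟨i, hi, -⟩)
    · exact hle i hi
    · exact (hle i hi).symm
  · rintro u v ⟨i, hi, hu⟩ ⟨j, hj, hv⟩
    obtain rfl : i = j := by
      by_contra hij
      exact Set.disjoint_left.1 (hdisj i j hij) ((H i).mem_edgeSet.2 hi)
        ((H j).mem_edgeSet.2 hj.symm)
    exact (hf i u v hi).1 hu hv
  · calc {v | ∃ i, (H i).Adj u v ∧ f i u = v}.ncard
        ≤ (Set.range fun i ↦ f i u).ncard :=
          Set.ncard_le_ncard (fun v ⟨i, _, hi⟩ ↦ ⟨i, hi⟩) (Set.toFinite _)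
      _ ≤ γ := by
          rw [← Set.image_univ]
          exact (Set.ncard_image_le Set.finite_univ).trans (by simp [Set.ncard_univ])
end
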